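/- Every countable quasicontinuous domain is quasialgebraic. -/

import Mathlib

open Set

/-- The upper set `↑A` generated by a subset `A` of a preordered set. -/
def upSet {P : Type*} [Preorder P] (A : Set P) : Set P := {y | ∃ a ∈ A, a ≤ y}

/-- The lower set `↓A` generated by a subset `A` of a preordered set. -/
def downSet {P : Type*} [Preorder P] (A : Set P) : Set P := {y | ∃ a ∈ A, y ≤ a}

/-- A poset is a dcpo if every (nonempty) directed subset has a least upper bound. -/
def IsDcpo (P : Type*) [Preorder P] : Prop :=
  ∀ D : Set P, D.Nonempty → DirectedOn (· ≤ ·) D → ∃ s, IsLUB D s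

/-- A subset `U` is Scott open if it is an upper set and every directed set whose
supremum lies in `U` meets `U`. -/
def ScottOpen {P : Type*} [Preorder P] (U : Set P) : Prop :=
  IsUpperSet U ∧ ∀ D : Set P, ∀ s : P, D.Nonempty → DirectedOn (· ≤ ·) D →
    IsLUB D s → s ∈ U → (D ∩ U).Nonempty

/-- The Scott topology `σ(P)`. -/
def scottT (P : Type*) [Preorder P] : TopologicalSpace P where
  IsOpen := ScottOpen
  isOpen_univ := ⟨isUpperSet_univ, fun D _ hD _ _ _ => hD.imp fun _ hd => ⟨hd, trivial⟩⟩
  isOpen_inter := by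
    rintro U V ⟨hU, hU'⟩ ⟨hV, hV'⟩
    refine ⟨hU.inter hV, fun D s hD hdir hlub hs => ?_⟩
    obtain ⟨d₁, hd₁D, hd₁U⟩ := hU' D s hD hdir hlub hs.1
    obtain ⟨d₂, hd₂D, hd₂V⟩ := hV' D s hD hdir hlub hs.2
    obtain ⟨d, hdD, h₁, h₂⟩ := hdir d₁ hd₁D d₂ hd₂D
    exact ⟨d, hdD, hU h₁ hd₁U, hV h₂ hd₂V⟩
  isOpen_sUnion := by
    intro S hS
    refine ⟨isUpperSet_sUnion fun U hU => (hS U hU).1, fun D s hD hdir hlub hs => ?_⟩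
    obtain ⟨U, hUS, hsU⟩ := hs
    obtain ⟨d, hdD, hdU⟩ := (hS U hUS).2 D s hD hdir hlub hsU
    exact ⟨d, hdD, U, hUS, hdU⟩

/-- Scott interior. -/
def scottInt (P : Type*) [Preorder P] (A : Set P) : Set P := @interior P (scottT P) A

/-- Scott closure. -/
def scottCl (P : Type*) [Preorder P] (A : Set P) : Set P := @closure P (scottT P) A

/-- The lower topology `ω(P)`, generated by the complements of principal upper sets. -/
def lowerT (P : Type*) [Preorder P] : TopologicalSpace P :=
  .generateFrom {V | ∃ x : P, V = (Ici x)ᶜ}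

/-- The upper topology `υ(P)`, generated by the complements of principal lower sets. -/
def upperT (P : Type*) [Preorder P] : TopologicalSpace P :=
  .generateFrom {V | ∃ x : P, V = (Iic x)ᶜ}

/-- The Lawson topology `λ(P)`, generated by `σ(P) ∪ ω(P)`. -/
def lawsonT (P : Type*) [Preorder P] : TopologicalSpace P :=
  .generateFrom ({U | ScottOpen U} ∪ {V | ∃ x : P, V = (Ici x)ᶜ})

/-- The interval topology `θ(P)`, generated by `ω(P) ∪ υ(P)`. -/
def intervalT (P : Type*) [Preorder P] : TopologicalSpace P :=
  .generateFrom ({V | ∃ x : P, V = (Ici x)ᶜ} ∪ {V | ∃ x : P, V = (Iic x)ᶜ})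

/-- `A ≪ B`: for every directed set `D` with `sup D ∈ ↑B`, `D` meets `↑A`. -/
def WayBelowSet {P : Type*} [Preorder P] (A B : Set P) : Prop :=
  ∀ D : Set P, ∀ s : P, D.Nonempty → DirectedOn (· ≤ ·) D → IsLUB D s →
    s ∈ upSet B → (D ∩ upSet A).Nonempty

/-- `u ≪ x`: every directed set `D` with `sup D ≥ x` contains some `d ≥ u`. -/
def WayBelowPt {P : Type*} [Preorder P] (u x : P) : Prop :=
  ∀ D : Set P, ∀ s : P, D.Nonempty → DirectedOn (· ≤ ·) D → IsLUB D s →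
    x ≤ s → ∃ d ∈ D, u ≤ d

/-- A family of sets is filtered if it is (nonempty and) directed under reverse inclusion. -/
def Filtered {P : Type*} (𝒜 : Set (Set P)) : Prop :=
  𝒜.Nonempty ∧ ∀ S ∈ 𝒜, ∀ T ∈ 𝒜, ∃ R ∈ 𝒜, R ⊆ S ∧ R ⊆ T

/-- The family `{↑F : F nonempty finite, F ≪ x}`. -/
def finWayFamily {P : Type*} [Preorder P] (x : P) : Set (Set P) :=
  {S | ∃ F : Set P, F.Nonempty ∧ F.Finite ∧ WayBelowSet F {x} ∧ S = upSet F}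

/-- A quasicontinuous domain. -/
def IsQuasicontinuousDomain (P : Type*) [Preorder P] : Prop :=
  ∀ x : P, Filtered (finWayFamily x) ∧ Ici x = ⋂₀ finWayFamily x

/-- The family `{↑F : F nonempty finite, x ∈ ↑F, F ≪ F}`. -/
def finCompactFamily {P : Type*} [Preorder P] (x : P) : Set (Set P) :=
  {S | ∃ F : Set P, F.Nonempty ∧ F.Finite ∧ x ∈ upSet F ∧ WayBelowSet F F ∧ S = upSet F}

/-- A quasialgebraic domain. -/
def IsQuasialgebraicDomain (P : Type*) [Preorder P] : Prop :=
  ∀ x : P, Filtered (finCompactFamily x) ∧ Ici x = ⋂₀ finCompactFamily x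

/-- A continuous domain: every `⇓x` is directed (hence nonempty) with supremum `x`. -/
def IsContinuousDomain (P : Type*) [Preorder P] : Prop :=
  ∀ x : P, {u | WayBelowPt u x}.Nonempty ∧ DirectedOn (· ≤ ·) {u | WayBelowPt u x} ∧
    IsLUB {u | WayBelowPt u x} x

/-- The set `K(P)` of compact elements. -/
def compacts (P : Type*) [Preorder P] : Set P := {k | WayBelowPt k k}

/-- An algebraic domain. -/
def IsAlgebraicDomain (P : Type*) [Preorder P] : Prop :=
  ∀ x : P, (compacts P ∩ Iic x).Nonempty ∧ DirectedOn (· ≤ ·) (compacts P ∩ Iic x) ∧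
    IsLUB (compacts P ∩ Iic x) x

/-- A meet-continuous dcpo: whenever `x ≤ sup D` for a directed set `D`,
`x` lies in the Scott closure of `↓x ∩ ↓D`. -/
def MeetContinuous (P : Type*) [Preorder P] : Prop :=
  ∀ x : P, ∀ D : Set P, ∀ s : P, D.Nonempty → DirectedOn (· ≤ ·) D → IsLUB D s → x ≤ s →
    x ∈ scottCl P (Iic x ∩ downSet D)

/-- The set of dyadic rationals in `[0,1]`. -/
def dyadics : Set ℝ := {t | ∃ m n : ℕ, m ≤ 2 ^ n ∧ t = (m : ℝ) / 2 ^ n}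

/-- A finitely generated upper set. -/
def FinGen {P : Type*} [Preorder P] (S : Set P) : Prop := ∃ F : Set P, F.Finite ∧ S = upSet F

/-- A nonempty finite set. -/
abbrev NonemptyFinite {P : Type*} (F : Set P) : Prop := F.Nonempty ∧ F.Finite

section

variable {P : Type*} [Preorder P] {A B C : Set P} {x : P}

theorem isUpperSet_upSet (A : Set P) : IsUpperSet (upSet A) :=
  fun _ _ hab ⟨c, hc, hca⟩ => ⟨c, hc, hca.trans hab⟩

theorem subset_upSet (A : Set P) : A ⊆ upSet A := fun a ha => ⟨a, ha, le_rfl⟩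

theorem upSet_subset_iff (hB : IsUpperSet B) : upSet A ⊆ B ↔ A ⊆ B :=
  ⟨(subset_upSet A).trans, fun h _ ⟨_, ha, hab⟩ => hB hab (h ha)⟩

theorem upSet_singleton (x : P) : upSet {x} = Ici x := by
  ext y; simp [upSet]

theorem WayBelowSet.anti_right (h : upSet B ⊆ upSet C) (hC : WayBelowSet A C) :
    WayBelowSet A B := fun D s hne hdir hs hsB => hC D s hne hdir hs (h hsB)

theorem WayBelowSet.mono_left (h : upSet A ⊆ upSet B) (hA : WayBelowSet A C) :
    WayBelowSet B C := fun D s hne hdir hs hsC =>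
  (hA D s hne hdir hs hsC).mono (inter_subset_inter_right D h)

theorem wayBelowSet_iff_forall : WayBelowSet A B ↔ ∀ b ∈ B, WayBelowSet A {b} := by
  refine ⟨fun h b hb => WayBelowSet.anti_right ?_ h, fun h D s hne hdir hs hsB => ?_⟩
  · exact (upSet_subset_iff (isUpperSet_upSet B)).2
      (singleton_subset_iff.2 (subset_upSet B hb))
  · obtain ⟨b, hb, hbs⟩ := hsB
    exact h b hb D s hne hdir hs ⟨b, rfl, hbs⟩

theorem WayBelowSet.upSet_subset (h : WayBelowSet A B) : upSet B ⊆ upSet A := by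
  intro y hy
  obtain ⟨z, rfl, hz⟩ := h {y} y (singleton_nonempty y) (directedOn_singleton _)
    isLUB_singleton hy
  exact hz

/-- Choosing a finite set way below each point of a finite set, and taking their union. -/
theorem exists_nonemptyFinite_wayBelowSet {p : Set P → Prop} (hp : ∀ F, p F ↔ ∀ a ∈ F, p {a})
    (hB : NonemptyFinite B)
    (h : ∀ b ∈ B, ∃ F, NonemptyFinite F ∧ WayBelowSet F {b} ∧ p F) :
    ∃ F, NonemptyFinite F ∧ WayBelowSet F B ∧ p F := by
  choose! f hf hfb hfp using h
  have hsub {b} (hb : b ∈ B) : upSet (f b) ⊆ upSet (⋃ b ∈ B, f b) :=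
    (upSet_subset_iff (isUpperSet_upSet _)).2
      ((subset_biUnion_of_mem (u := f) hb).trans (subset_upSet _))
  refine ⟨⋃ b ∈ B, f b, ⟨?_, hB.2.biUnion fun b hb => (hf b hb).2⟩, ?_, ?_⟩
  · obtain ⟨b, hb⟩ := hB.1
    exact (hf b hb).1.mono (subset_biUnion_of_mem (u := f) hb)
  · exact wayBelowSet_iff_forall.2 fun b hb => (hfb b hb).mono_left (hsub hb)
  · rw [hp]
    intro a ha
    obtain ⟨b, hb, hab⟩ := mem_iUnion₂.1 ha
    exact (hp _).1 (hfp b hb) a hab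

/-- A sequence of nonempty finite sets, each of which lies in the upper closure of its
predecessor, admits a monotone sequence of representatives. -/
theorem exists_monotone_forall_mem {F : ℕ → Set P} (hne : ∀ n, (F n).Nonempty)
    (hfin : ∀ n, (F n).Finite) (hF : ∀ n, F (n + 1) ⊆ upSet (F n)) :
    ∃ c : ℕ → P, Monotone c ∧ ∀ n, c n ∈ F n := by
  have hstep (n : ℕ) (a : F (n + 1)) : ∃ b : F n, (b : P) ≤ a := by
    obtain ⟨b, hb, hba⟩ := hF n a.2
    exact ⟨⟨b, hb⟩, hba⟩
  choose π hπ using hstep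
  let G :=
    CategoryTheory.Functor.ofOpSequence (X := fun n => (F n : Type _))
      (fun n => TypeCat.ofHom (π n))
  have (j : ℕᵒᵖ) : Finite (G.obj j) := (hfin j.unop).to_subtype
  have (j : ℕᵒᵖ) : Nonempty (G.obj j) := (hne j.unop).to_subtype
  obtain ⟨s, hs⟩ := nonempty_sections_of_finite_inverse_system G
  let c : (n : ℕ) → F n := fun n => s (Opposite.op n)
  refine ⟨fun n => c n, monotone_nat_of_le_succ fun n => ?_, fun n => (c n).2⟩
  have h : π n (c (n + 1)) = c n := by
    have := hs (CategoryTheory.homOfLE (Nat.le_add_right n 1)).op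
    rw [CategoryTheory.Functor.ofOpSequence_map_homOfLE_succ] at this
    exact this
  exact h ▸ hπ n (c (n + 1))

/-- Rudin's lemma for countable families: if every directed set whose supremum lies in the
intersection of a filtered family of finitely generated upper sets meets the upper set `V`, then
`V` contains a member of the family. -/
theorem Filtered.exists_subset_of_isUpperSet (hdcpo : IsDcpo P) {𝒜 : Set (Set P)}
    (h𝒜 : Filtered 𝒜) (hc : 𝒜.Countable) (hfg : ∀ S ∈ 𝒜, FinGen S) {V : Set P}
    (hV : IsUpperSet V)
    (h : ∀ D : Set P, ∀ s, D.Nonempty → DirectedOn (· ≤ ·) D → IsLUB D s → s ∈ ⋂₀ 𝒜 →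
      (D ∩ V).Nonempty) : ∃ S ∈ 𝒜, S ⊆ V := by
  by_contra! hcon
  have := hc.to_subtype
  have := h𝒜.1.to_subtype
  let _ : Encodable 𝒜 := Encodable.ofCountable 𝒜
  let _ : Inhabited 𝒜 := Classical.inhabited_of_nonempty this
  have hdir : Directed (· ≥ ·) (Subtype.val : 𝒜 → Set P) := by
    rintro ⟨S, hS⟩ ⟨T, hT⟩
    obtain ⟨R, hR, hRS, hRT⟩ := h𝒜.2 S hS T hT
    exact ⟨⟨R, hR⟩, hRS, hRT⟩
  let B : ℕ → 𝒜 := hdir.sequence _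
  have hanti : ∀ n, (B (n + 1) : Set P) ⊆ B n := fun n => hdir.sequence_anti n.le_succ
  choose! F hFfin hF using hfg
  have hmem (n : ℕ) : (B n : Set P) = upSet (F (B n)) := hF _ (B n).2
  obtain ⟨c, hcmono, hcF⟩ := exists_monotone_forall_mem (F := fun n => F (B n) \ V)
    (fun n => by
      rw [sdiff_nonempty, ← upSet_subset_iff hV, ← hmem]
      exact hcon _ (B n).2)
    (fun n => (hFfin _ (B n).2).sdiff)
    (fun n a ha => by
      have : a ∈ upSet (F (B n)) := by
        rw [← hmem]
        apply hanti
        rw [hmem]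
        exact subset_upSet _ ha.1
      obtain ⟨b, hb, hba⟩ := this
      exact ⟨b, ⟨hb, fun hbV => ha.2 (hV hba hbV)⟩, hba⟩)
  have hdirc := directedOn_range.2 hcmono.directed_le
  obtain ⟨s, hs⟩ := hdcpo (range c) (range_nonempty c) hdirc
  obtain ⟨_, ⟨n, rfl⟩, hn⟩ := h (range c) s (range_nonempty c) hdirc hs fun S hS => by
    refine hdir.sequence_le ⟨S, hS⟩ ?_
    change s ∈ (B _ : Set P)
    rw [hmem]
    exact ⟨_, (hcF _).1, hs.1 ⟨_, rfl⟩⟩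
  exact (hcF n).2 hn

theorem countable_setOf_finGen [Countable P] : {S : Set P | FinGen S}.Countable := by
  refine (Set.Countable.ofPred_finite.image (upSet (P := P))).mono ?_
  rintro _ ⟨F, hF, rfl⟩
  exact ⟨F, hF, rfl⟩

/-- The interpolation property of a countable quasicontinuous domain, at a point. -/
theorem IsQuasicontinuousDomain.exists_wayBelowSet_wayBelowSet_singleton [Countable P]
    (hdcpo : IsDcpo P) (hqc : IsQuasicontinuousDomain P) (h : WayBelowSet A {x}) :
    ∃ E, NonemptyFinite E ∧ WayBelowSet A E ∧ WayBelowSet E {x} := by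
  have subset_iff (T F : Set P) : upSet F ⊆ upSet T ↔ ∀ a ∈ F, upSet {a} ⊆ upSet T := by
    simp only [upSet_subset_iff (isUpperSet_upSet T), singleton_subset_iff]
    rfl
  let 𝒜 : Set (Set P) := {S | ∃ H, NonemptyFinite H ∧ S = upSet H ∧
    ∃ E, NonemptyFinite E ∧ WayBelowSet H E ∧ WayBelowSet E {x}}
  have hfilt : Filtered 𝒜 := by
    constructor
    · obtain ⟨_, E, hE, hE', hEx, rfl⟩ := (hqc x).1.1
      obtain ⟨H, hH, hHE, -⟩ := exists_nonemptyFinite_wayBelowSet (p := fun _ => True)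
        (by simp) ⟨hE, hE'⟩ fun e _ => by
          obtain ⟨_, H, hH, hH', hHe, rfl⟩ := (hqc e).1.1
          exact ⟨H, ⟨hH, hH'⟩, hHe, trivial⟩
      exact ⟨_, H, hH, rfl, E, ⟨hE, hE'⟩, hHE, hEx⟩
    · rintro _ ⟨H₁, hH₁, rfl, E₁, hE₁, hHE₁, hEx₁⟩ _ ⟨H₂, hH₂, rfl, E₂, hE₂, hHE₂, hEx₂⟩
      obtain ⟨_, ⟨E, hE, hE', hEx, rfl⟩, h₁, h₂⟩ := (hqc x).1.2 _ ⟨E₁, hE₁.1, hE₁.2, hEx₁, rfl⟩ _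
        ⟨E₂, hE₂.1, hE₂.2, hEx₂, rfl⟩
      obtain ⟨H, hH, hHE, hH₁, hH₂⟩ := exists_nonemptyFinite_wayBelowSet
        (p := fun F => upSet F ⊆ upSet H₁ ∧ upSet F ⊆ upSet H₂)
        (fun F => by rw [subset_iff, subset_iff]; simp only [← forall₂_and]) ⟨hE, hE'⟩
        fun e he => by
          obtain ⟨_, ⟨H, hH, hH', hHe, rfl⟩, h⟩ := (hqc e).1.2
            _ ⟨H₁, hH₁.1, hH₁.2, wayBelowSet_iff_forall.1 (WayBelowSet.anti_right h₁ hHE₁) e he,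
              rfl⟩
            _ ⟨H₂, hH₂.1, hH₂.2, wayBelowSet_iff_forall.1 (WayBelowSet.anti_right h₂ hHE₂) e he,
              rfl⟩
          exact ⟨H, ⟨hH, hH'⟩, hHe, h⟩
      exact ⟨_, ⟨H, hH, rfl, E, ⟨hE, hE'⟩, hHE, hEx⟩, hH₁, hH₂⟩
  have hinter : ⋂₀ 𝒜 ⊆ Ici x := by
    intro y hy
    rw [(hqc x).2]
    rintro _ ⟨E, hE, hE', hEx, rfl⟩
    by_contra hyE
    obtain ⟨H, hH, hHE, hyH⟩ := exists_nonemptyFinite_wayBelowSet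
      (p := fun F => y ∉ upSet F) (fun F => by simp [upSet]) ⟨hE, hE'⟩ fun e he => by
        have hye : y ∉ Ici e := fun hey => hyE ⟨e, he, hey⟩
        rw [(hqc e).2, mem_sInter] at hye
        push Not at hye
        obtain ⟨_, ⟨H, hH, hH', hHe, rfl⟩, hyH⟩ := hye
        exact ⟨H, ⟨hH, hH'⟩, hHe, hyH⟩
    exact hyH (hy _ ⟨H, hH, rfl, E, ⟨hE, hE'⟩, hHE, hEx⟩)
  have hfg : ∀ S ∈ 𝒜, FinGen S := by
    rintro _ ⟨H, hH, rfl, -⟩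
    exact ⟨H, hH.2, rfl⟩
  obtain ⟨_, ⟨H, -, rfl, E, hE, hHE, hEx⟩, hHA⟩ := hfilt.exists_subset_of_isUpperSet hdcpo
    (countable_setOf_finGen.mono hfg) hfg (isUpperSet_upSet A) fun D s hne hdir hs hsA =>
      h D s hne hdir hs (upSet_singleton x ▸ hinter hsA)
  exact ⟨E, hE, hHE.mono_left hHA, hEx⟩

/-- The interpolation property of a countable quasicontinuous domain. -/
theorem IsQuasicontinuousDomain.exists_wayBelowSet_wayBelowSet [Countable P]
    (hdcpo : IsDcpo P) (hqc : IsQuasicontinuousDomain P) (hB : NonemptyFinite B)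
    (h : WayBelowSet A B) :
    ∃ E, NonemptyFinite E ∧ WayBelowSet A E ∧ WayBelowSet E B := by
  obtain ⟨E, hE, hEB, hAE⟩ := exists_nonemptyFinite_wayBelowSet (p := WayBelowSet A)
    (fun F => wayBelowSet_iff_forall) hB fun b hb => by
      obtain ⟨E, hE, hAE, hEb⟩ :=
        hqc.exists_wayBelowSet_wayBelowSet_singleton hdcpo (wayBelowSet_iff_forall.1 h b hb)
      exact ⟨E, hE, hEb, hAE⟩
  exact ⟨E, hE, hAE, hEB⟩

/-- Between `A ≪ B` one can insert `F ≪ G`, with `G ≪ B`, such that `↑F` and `↑G` agree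
at a prescribed point. -/
theorem IsQuasicontinuousDomain.exists_wayBelowSet_decide [Countable P] (hdcpo : IsDcpo P)
    (hqc : IsQuasicontinuousDomain P) (hB : NonemptyFinite B) (h : WayBelowSet A B) (y : P) :
    ∃ F G, NonemptyFinite F ∧ NonemptyFinite G ∧ WayBelowSet F G ∧ WayBelowSet A F ∧
      WayBelowSet G B ∧ (y ∈ upSet F → y ∈ upSet G) := by
  obtain ⟨H, hH, hAH, hHB⟩ := hqc.exists_wayBelowSet_wayBelowSet hdcpo hB h
  by_cases hy : y ∈ upSet H
  · obtain ⟨F, hF, hAF, hFH⟩ := hqc.exists_wayBelowSet_wayBelowSet hdcpo hH hAH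
    exact ⟨F, H, hF, hH, hFH, hAF, hHB, fun _ => hy⟩
  · obtain ⟨G, hG, hHG, hGB⟩ := hqc.exists_wayBelowSet_wayBelowSet hdcpo hB hHB
    exact ⟨H, G, hH, hG, hHG, hAH, hGB, fun hyH => absurd hyH hy⟩

/-- In a countable quasicontinuous domain, a compact open upper set can be inserted between
`A ≪ B`. -/
theorem IsQuasicontinuousDomain.exists_wayBelowSet_self [Countable P] (hdcpo : IsDcpo P)
    (hqc : IsQuasicontinuousDomain P) (hA : NonemptyFinite A) (hB : NonemptyFinite B)
    (h : WayBelowSet A B) :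
    ∃ F, NonemptyFinite F ∧ WayBelowSet F F ∧ upSet F ⊆ upSet A ∧ upSet B ⊆ upSet F := by
  have : Nonempty P := hA.1.nonempty
  obtain ⟨p, hp⟩ := exists_surjective_nat P
  let Q := {q : Set P × Set P // NonemptyFinite q.1 ∧ NonemptyFinite q.2 ∧ WayBelowSet q.1 q.2}
  have hstep (n : ℕ) (q : Q) : ∃ r : Q, WayBelowSet q.1.1 r.1.1 ∧ WayBelowSet r.1.2 q.1.2 ∧
      (p n ∈ upSet r.1.1 → p n ∈ upSet r.1.2) := by
    obtain ⟨F, G, hF, hG, hFG, h⟩ := hqc.exists_wayBelowSet_decide hdcpo q.2.2.1 q.2.2.2 (p n)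
    exact ⟨⟨(F, G), hF, hG, hFG⟩, h⟩
  choose next hnext₁ hnext₂ hnext using hstep
  let q : ℕ → Q := fun n => Nat.rec ⟨(A, B), hA, hB, h⟩ next n
  let F : ℕ → Set P := fun n => (q n).1.1
  let G : ℕ → Set P := fun n => (q n).1.2
  have hF (n) : NonemptyFinite (F n) := (q n).2.1
  have hFG (n) : WayBelowSet (F n) (G n) := (q n).2.2.2
  have hFanti : Antitone fun n => upSet (F n) :=
    antitone_nat_of_succ_le fun n => (hnext₁ n (q n)).upSet_subset
  have hGmono : Monotone fun n => upSet (G n) :=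
    monotone_nat_of_le_succ fun n => (hnext₂ n (q n)).upSet_subset
  have hinter : ⋂₀ range (fun n => upSet (F n)) ⊆ ⋃ n, upSet (G n) := by
    intro y hy
    obtain ⟨n, rfl⟩ := hp y
    exact mem_iUnion.2 ⟨n + 1, hnext n (q n) (hy _ ⟨n + 1, rfl⟩)⟩
  have hopen : ∀ D : Set P, ∀ s, D.Nonempty → DirectedOn (· ≤ ·) D → IsLUB D s →
      s ∈ ⋃ n, upSet (G n) → (D ∩ ⋃ n, upSet (G n)).Nonempty := by
    intro D s hne hdir hs hsG
    obtain ⟨n, hn⟩ := mem_iUnion.1 hsG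
    exact (hnext₂ n (q n) D s hne hdir hs hn).mono
      (inter_subset_inter_right D (subset_iUnion (fun n => upSet (G n)) (n + 1)))
  have hGF (m n) : upSet (G m) ⊆ upSet (F n) :=
    (hGmono (le_max_left m n)).trans
      ((hFG (max m n)).upSet_subset.trans (hFanti (le_max_right m n)))
  obtain ⟨_, ⟨n, rfl⟩, hn⟩ := Filtered.exists_subset_of_isUpperSet hdcpo
    (𝒜 := range fun n => upSet (F n)) (V := ⋃ n, upSet (G n))
    ⟨range_nonempty _, by
      rintro _ ⟨m, rfl⟩ _ ⟨n, rfl⟩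
      exact ⟨_, ⟨max m n, rfl⟩, hFanti (le_max_left m n), hFanti (le_max_right m n)⟩⟩
    (countable_range _) (by rintro _ ⟨n, rfl⟩; exact ⟨F n, (hF n).2, rfl⟩)
    (isUpperSet_iUnion fun n => isUpperSet_upSet (G n))
    fun D s hne hdir hs hsF => hopen D s hne hdir hs (hinter hsF)
  have heq : upSet (F n) = ⋃ m, upSet (G m) := hn.antisymm (iUnion_subset fun m => hGF m n)
  refine ⟨F n, hF n, ?_, hFanti (Nat.zero_le n), hGF 0 n⟩
  intro D s hne hdir hs hsF
  rw [heq] at hsF ⊢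
  exact hopen D s hne hdir hs hsF

end

/-- Every countable quasicontinuous domain is quasialgebraic. -/
theorem countable_quasicontinuous_is_quasialgebraic
    (P : Type*) [PartialOrder P] [Countable P] (hdcpo : IsDcpo P)
    (hqc : IsQuasicontinuousDomain P) : IsQuasialgebraicDomain P := by
  intro x
  have key : ∀ S ∈ finWayFamily x, ∃ R ∈ finCompactFamily x, R ⊆ S := by
    rintro _ ⟨E, hE, hE', hEx, rfl⟩
    obtain ⟨F, hF, hFF, hFE, hxF⟩ := hqc.exists_wayBelowSet_self hdcpo ⟨hE, hE'⟩
      ⟨singleton_nonempty x, finite_singleton x⟩ hEx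
    exact ⟨_, ⟨F, hF.1, hF.2, hxF (subset_upSet _ rfl), hFF, rfl⟩, hFE⟩
  have hsub : finCompactFamily x ⊆ finWayFamily x := by
    rintro _ ⟨F, hF, hF', hxF, hFF, rfl⟩
    refine ⟨F, hF, hF', WayBelowSet.anti_right ?_ hFF, rfl⟩
    exact (upSet_subset_iff (isUpperSet_upSet F)).2 (singleton_subset_iff.2 hxF)
  refine ⟨⟨?_, fun S hS T hT => ?_⟩, Subset.antisymm ?_ ?_⟩
  · obtain ⟨S, hS⟩ := (hqc x).1.1
    obtain ⟨R, hR, -⟩ := key S hS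
    exact ⟨R, hR⟩
  · obtain ⟨E, hE, hES, hET⟩ := (hqc x).1.2 S (hsub hS) T (hsub hT)
    obtain ⟨R, hR, hRE⟩ := key E hE
    exact ⟨R, hR, hRE.trans hES, hRE.trans hET⟩
  · rw [(hqc x).2]
    exact sInter_subset_sInter hsub
  · rw [(hqc x).2]
    intro y hy S hS
    obtain ⟨R, hR, hRS⟩ := key S hS
    exact hRS (hy R hR)
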